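/- arXiv:1612.09482 — 3 statements merged into one kernel-verified Lean document; each statement's English description precedes it below -/
import Mathlib

section
/- Let R be a unital ring with involution and a ∈ R. Then a is dual core invertible if and only if a is group invertible and a has a {1,4}-inverse. In this case, for any {1,4}-inverse a^{(1,4)} of a, the dual core inverse of a is a_co = a^{(1,4)} a a^#. -/
/-- `x` is the dual core inverse of `a`. -/
def IsDualCoreInverse {R : Type*} [Ring R] [StarRing R] (a x : R) : Prop :=
  a * x * a = a ∧ x * a * x = x ∧ star (x * a) = x * a ∧ x * x * a = x ∧ a * a * x = a

/-- `z` is the group inverse of `a`. -/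
def IsGroupInverse {R : Type*} [Ring R] (a z : R) : Prop :=
  a * z * a = a ∧ z * a * z = z ∧ a * z = z * a

/-- If `x` is the dual core inverse of `a`, then `a * x * x` is the group inverse of `a`. -/
theorem IsDualCoreInverse.isGroupInverse {R : Type*} [Ring R] [StarRing R] {a x : R}
    (h : IsDualCoreInverse a x) : IsGroupInverse a (a * x * x) := by
  obtain ⟨h₁, -, -, h₄, h₅⟩ := h
  have hl : a * (a * x * x) = a * x := by rw [← mul_assoc, ← mul_assoc, h₅]
  have hr : a * x * x * a = a * x := by rw [mul_assoc, mul_assoc, ← mul_assoc x, h₄]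
  refine ⟨by rw [hl, h₁], ?_, hl.trans hr.symm⟩
  rw [hr, ← mul_assoc, ← mul_assoc, h₁]

/-- If `z` is the group inverse of `a` and `y` is a {1,4}-inverse of `a`, then `y * a * z` is the
dual core inverse of `a`. -/
theorem IsGroupInverse.isDualCoreInverse {R : Type*} [Ring R] [StarRing R] {a z y : R}
    (hz : IsGroupInverse a z) (hy : a * y * a = a) (hs : star (y * a) = y * a) :
    IsDualCoreInverse a (y * a * z) := by
  obtain ⟨h₁, -, h₃⟩ := hz
  have hl : a * (y * a * z) = a * z := by rw [← mul_assoc, ← mul_assoc, hy]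
  have hr : y * a * z * a = y * a := by rw [mul_assoc, mul_assoc, ← mul_assoc a, h₁]
  refine ⟨by rw [hl, h₁], ?_, by rw [hr, hs], ?_, by rw [mul_assoc, hl, h₃, ← mul_assoc, h₁]⟩
  · rw [hr, mul_assoc, hl, ← mul_assoc]
  · rw [mul_assoc, hr, mul_assoc y, h₃, mul_assoc, mul_assoc z, ← mul_assoc a, hy]

/-- `a` is dual core invertible iff `a` is group invertible and has a
{1,4}-inverse; in that case, for any group inverse `z` and any {1,4}-inverse `y`
of `a`, the dual core inverse of `a` is `y * a * z`. -/
theorem dual_core_inverse_iff_group_and_14 {R : Type*} [Ring R] [StarRing R] (a : R) :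
    ((∃ x, IsDualCoreInverse a x) ↔
      (∃ z, IsGroupInverse a z) ∧ (∃ y, a * y * a = a ∧ star (y * a) = y * a)) ∧
    (∀ z y, IsGroupInverse a z → (a * y * a = a ∧ star (y * a) = y * a) →
      IsDualCoreInverse a (y * a * z)) := by
  refine ⟨⟨?_, ?_⟩, fun z y hz hy => hz.isDualCoreInverse hy.1 hy.2⟩
  · rintro ⟨x, hx⟩
    exact ⟨⟨_, hx.isGroupInverse⟩, x, hx.1, hx.2.2.1⟩
  · rintro ⟨⟨z, hz⟩, y, hy, hs⟩
    exact ⟨_, hz.isDualCoreInverse hy hs⟩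
end

section
/- Let R be a unital ring with involution, a ∈ R core invertible with core inverse a^co, and e ∈ R such that 1 + a^co e is invertible. With β = (1 + e a^co)⁻¹, α = (1 + a^co e)⁻¹, ε = (1 − a a^co) e α (1 − a^co a), f = a + e − ε, f₀ = α a^co, and δ = β* (a^co)* e* (1 − a a^co) β, one has 1 − δ − f f₀ = β* (1 − a a^co) β; moreover, if 1 − δ is invertible, then f f₀ is core invertible with core inverse (f f₀)^co = f f₀ (1 − δ)⁻¹. -/
/-- `x` is the core inverse of `a`. -/
def IsCoreInverse {R : Type*} [Ring R] [StarRing R] (a x : R) : Prop :=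
  a * x * a = a ∧ x * a * x = x ∧ star (a * x) = a * x ∧ a * (x * x) = x ∧ x * (a * a) = a

/-- Jacobson's lemma with plus signs. -/
theorem isUnit_one_add_mul_swap {R : Type*} [Ring R] {a b : R} (h : IsUnit (1 + a * b)) :
    IsUnit (1 + b * a) := by
  obtain ⟨u, hu⟩ := h
  have h₁ : (1 + a * b) * ↑u⁻¹ = 1 := by rw [← hu, Units.mul_inv]
  have h₂ : ↑u⁻¹ * (1 + a * b) = 1 := by rw [← hu, Units.inv_mul]
  refine ⟨⟨1 + b * a, 1 - b * ↑u⁻¹ * a, ?_, ?_⟩, rfl⟩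
  · calc (1 + b * a) * (1 - b * ↑u⁻¹ * a) = 1 + b * a - b * ((1 + a * b) * ↑u⁻¹) * a := by
          noncomm_ring
      _ = 1 := by rw [h₁]; noncomm_ring
  · calc (1 - b * ↑u⁻¹ * a) * (1 + b * a) = 1 + b * a - b * (↑u⁻¹ * (1 + a * b)) * a := by
          noncomm_ring
      _ = 1 := by rw [h₂]; noncomm_ring

/-- If `h` is idempotent and `1 - h + h* h` is invertible, then the idempotent `1 - h` is core
invertible with core inverse `(1 - h) (1 - h + h* h)⁻¹`. -/
theorem isCoreInverse_one_sub_of_isIdempotentElem {R : Type*} [Ring R] [StarRing R] {h : R}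
    (hh : IsIdempotentElem h) (hu : IsUnit (1 - h + star h * h)) :
    IsCoreInverse (1 - h) ((1 - h) * Ring.inverse (1 - h + star h * h)) := by
  set g := 1 - h with hg
  set d := g + star h * h with hd
  set u := Ring.inverse d
  have hgg : g * g = g := hh.one_sub
  have hhg : h * g = 0 := hh.mul_one_sub_self
  have hud : u * d = 1 := Ring.inverse_mul_cancel d hu
  have hdu : d * u = 1 := Ring.mul_inverse_cancel d hu
  have hdg : d * g = g := by rw [hd, add_mul, hgg, mul_assoc, hhg, mul_zero, add_zero]
  have hug : u * g = g := by rw [← hdg, ← mul_assoc, hud, one_mul, hdg]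
  have hXg : g * u * g = g := by rw [mul_assoc, hug, hgg]
  have hgX : g * (g * u) = g * u := by rw [← mul_assoc, hgg]
  have hsg : star g * star h = 0 := by rw [← star_mul, hhg, star_zero]
  have hsgd : star g * d = star g * g := by
    rw [hd, mul_add, ← mul_assoc, hsg, zero_mul, add_zero]
  have hdsg : star d * g = star g * g := by
    simpa using congrArg star hsgd
  have hsud : star u * star d = 1 := by rw [← star_mul, hdu, star_one]
  have hsa : star (g * u) = g * u := by
    calc star (g * u) = star u * (star g * d) * u := by
          rw [star_mul, mul_assoc, mul_assoc, hdu, mul_one]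
      _ = star u * star d * (g * u) := by rw [hsgd, ← hdsg]; simp only [mul_assoc]
      _ = g * u := by rw [hsud, one_mul]
  refine ⟨?_, ?_, ?_, ?_, ?_⟩
  · rw [hgX, hXg]
  · rw [hXg, hgX]
  · rw [hgX, hsa]
  · rw [← mul_assoc, hgX, ← mul_assoc, hXg]
  · rw [hgg, hXg]


/-- `1 - δ - f f₀ = β* (1 - a a^co) β`; if moreover `1 - δ` is
invertible, then `f f₀` is core invertible with core inverse `f f₀ (1 - δ)⁻¹`. -/
theorem ffzero_core_inverse {R : Type*} [Ring R] [StarRing R] (a aco e : R)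
    (ha : IsCoreInverse a aco)
    (hu : IsUnit (1 + aco * e))
    (α β ε f f₀ δ : R)
    (hα : α = Ring.inverse (1 + aco * e))
    (hβ : β = Ring.inverse (1 + e * aco))
    (hε : ε = (1 - a * aco) * e * α * (1 - aco * a))
    (hf : f = a + e - ε)
    (hf₀ : f₀ = α * aco)
    (hδ : δ = star β * star aco * star e * (1 - a * aco) * β) :
    1 - δ - f * f₀ = star β * (1 - a * aco) * β ∧
    (IsUnit (1 - δ) →
      IsCoreInverse (f * f₀) (f * f₀ * Ring.inverse (1 - δ))) := by
  obtain ⟨hax, hxax, hsa, -⟩ := ha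
  have hv : IsUnit (1 + e * aco) := isUnit_one_add_mul_swap hu
  have hαl : α * (1 + aco * e) = 1 := hα ▸ Ring.inverse_mul_cancel _ hu
  have hβl : β * (1 + e * aco) = 1 := hβ ▸ Ring.inverse_mul_cancel _ hv
  have hβr : (1 + e * aco) * β = 1 := hβ ▸ Ring.mul_inverse_cancel _ hv
  have hf₀β : f₀ = aco * β := by
    calc f₀ = α * (aco * (1 + e * aco)) * β := by
          rw [hf₀, mul_assoc, mul_assoc, hβr, mul_one]
      _ = α * (1 + aco * e) * aco * β := by noncomm_ring
      _ = aco * β := by rw [hαl, one_mul]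
  set q := 1 - a * aco with hq
  have hkill : (1 - aco * a) * aco = 0 := by rw [sub_mul, one_mul, hxax, sub_self]
  have hεf₀ : ε * f₀ = 0 := by
    have h₁ : (1 - aco * a) * f₀ = 0 := by rw [hf₀β, ← mul_assoc, hkill, zero_mul]
    rw [hε, mul_assoc, h₁, mul_zero]
  have hff₀ : f * f₀ = 1 - q * β := by
    calc f * f₀ = (a + e) * f₀ - ε * f₀ := by rw [hf, sub_mul]
      _ = (1 + e * aco) * β - q * β := by rw [hεf₀, hf₀β, hq]; noncomm_ring
      _ = 1 - q * β := by rw [hβr]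
  have hqq : q * q = q :=
    IsIdempotentElem.one_sub (show a * aco * (a * aco) = a * aco by rw [← mul_assoc, hax])
  have hsq : star q = q := by rw [hq, star_sub, star_one, hsa]
  have hxq : aco * q = 0 := by rw [hq, mul_sub, mul_one, ← mul_assoc, hxax, sub_self]
  have hβq : β * q = q := by
    calc β * q = β * (1 + e * aco) * q := by
          rw [mul_assoc, add_mul, mul_assoc, hxq, mul_zero, add_zero, one_mul]
      _ = q := by rw [hβl, one_mul]
  have hidem : IsIdempotentElem (q * β) := by
    rw [IsIdempotentElem, mul_assoc, ← mul_assoc β, hβq, ← mul_assoc, hqq]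
  have hstar : star (q * β) * (q * β) = star β * q * β := by
    rw [star_mul, hsq, mul_assoc, ← mul_assoc q, hqq, mul_assoc]
  have hδ' : 1 - δ = 1 - q * β + star (q * β) * (q * β) := by
    have h₁ : star β * star aco * star e = 1 - star β := by
      rw [mul_assoc, ← star_mul, ← star_mul, eq_sub_iff_add_eq', ← star_add, ← star_one R, ← hβr,
        add_mul, one_mul]
    rw [hδ, h₁, hstar]
    noncomm_ring
  constructor
  · rw [hδ', hff₀, hstar, add_sub_cancel_left]
  · rw [hδ', hff₀]
    exact isCoreInverse_one_sub_of_isIdempotentElem hidem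
end

section
/- Let R be a unital ring with involution, J(R) its Jacobson radical, a ∈ R core invertible with core inverse a^co, and j ∈ J(R) such that (1 − a a^co) j (1 + a^co j)⁻¹ (1 − a^co a) = 0. Then a + j is core invertible and, setting γ = (1 + a^co j)⁻¹ (1 − a^co a)(1 + j a^co) a a^co (1 + j a^co)⁻¹ and δ = (1 + (a^co)* j*)⁻¹ (a^co)* j* (1 − a a^co)(1 + j a^co)⁻¹, the elements 1 − γ and 1 − δ are invertible and (a + j)^co = (1 − γ)⁻¹ (1 + a^co j)⁻¹ a^co (1 − δ)⁻¹. -/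
theorem Ideal.isUnit_one_add_of_mem_jacobson_bot {R : Type*} [Ring R] {x : R}
    (hx : x ∈ Ideal.jacobson (⊥ : Ideal R)) : IsUnit (1 + x) := by
  have left_inv : ∀ t ∈ Ideal.jacobson (⊥ : Ideal R), ∃ z, z * (1 + t) = 1 := fun t ht ↦ by
    obtain ⟨z, hz⟩ := Ideal.mem_jacobson_iff.1 ht 1
    rw [Ideal.mem_bot] at hz
    exact ⟨z, by linear_combination (norm := noncomm_ring) hz⟩
  obtain ⟨z, hz⟩ := left_inv x hx
  obtain ⟨y, hy⟩ := left_inv (-(z * x)) (neg_mem (Ideal.mul_mem_left _ z hx))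
  have hz' : 1 + -(z * x) = z := by linear_combination (norm := noncomm_ring) -hz
  rw [hz'] at hy
  exact ⟨⟨1 + x, z, by rw [← left_inv_eq_right_inv hy hz]; exact hy, hz⟩, rfl⟩

theorem Ideal.star_mem_jacobson_bot {R : Type*} [Ring R] [StarRing R] {x : R}
    (hx : x ∈ Ideal.jacobson (⊥ : Ideal R)) : star x ∈ Ideal.jacobson (⊥ : Ideal R) := by
  refine Ideal.mem_jacobson_iff.2 fun y ↦ ?_
  have hu : IsUnit (1 + y * star x) := by
    simpa using (Ideal.isUnit_one_add_of_mem_jacobson_bot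
      (Ideal.mul_mem_right (star y) _ hx)).star
  obtain ⟨z, hz⟩ := hu.exists_left_inv
  exact ⟨z, by rw [Ideal.mem_bot]; linear_combination (norm := noncomm_ring) hz⟩

theorem IsIdempotentElem.eq_zero_of_mem_jacobson_bot {R : Type*} [Ring R] {t : R}
    (ht : IsIdempotentElem t) (hJ : t ∈ Ideal.jacobson (⊥ : Ideal R)) : t = 0 := by
  have hu := Ideal.isUnit_one_add_of_mem_jacobson_bot (neg_mem hJ)
  refine hu.mul_left_eq_zero.1 ?_
  rw [mul_add, mul_one, mul_neg, ht.eq, add_neg_cancel]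

/-- A reflexive inverse `b` of `w` is corrected to the core inverse by `g⁻¹` and `d⁻¹`, where
`g = 1 - (1 - b w) w b` and `d = 1 - (w b)* (1 - w b)`. -/
theorem isCoreInverse_of_reflexive_inverse {R : Type*} [Ring R] [StarRing R]
    {w b g g' d d' : R} (hwb : w * b * w = w) (hbw : b * w * b = b)
    (hg : g = 1 - (1 - b * w) * (w * b)) (hg' : g' * g = 1) (hgg' : g * g' = 1)
    (hd : d = 1 - star (w * b) * (1 - w * b)) (hd' : d' * d = 1) (hdd' : d * d' = 1)
    (hmem : (1 - w * b) * (g' * (b * w)) ∈ Ideal.jacobson (⊥ : Ideal R)) :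
    IsCoreInverse w (g' * b * d') := by
  obtain ⟨e, he⟩ : ∃ e, e = w * b := ⟨_, rfl⟩
  obtain ⟨f, hf⟩ : ∃ f, f = b * w := ⟨_, rfl⟩
  rw [← he, ← hf] at hg hmem
  rw [← he] at hd
  have hee : e * e = e := by rw [he, ← mul_assoc, hwb]
  have hff : f * f = f := by rw [hf, ← mul_assoc, hbw]
  have hew : e * w = w := by rw [he, hwb]
  have hwf : w * f = w := by rw [hf, ← mul_assoc, hwb]
  have hfb : f * b = b := by rw [hf, hbw]
  have hfg : f * g = f := by
    rw [hg]
    linear_combination (norm := noncomm_ring) hff * e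
  have hge : g * e = f * e := by
    rw [hg]
    linear_combination (norm := noncomm_ring) f * hee - hee
  have hfg' : f * g' = f := by
    calc f * g' = f * g * g' := by rw [hfg]
      _ = f := by rw [mul_assoc, hgg', mul_one]
  have hme : g' * f * e = e := by rw [mul_assoc, ← hge, ← mul_assoc, hg', one_mul]
  have hidem : IsIdempotentElem ((1 - e) * (g' * f)) := by
    change (1 - e) * (g' * f) * ((1 - e) * (g' * f)) = (1 - e) * (g' * f)
    linear_combination (norm := noncomm_ring)
      (1 - e) * g' * hfg' * f + (1 - e) * g' * hff - (1 - e) * hme * g' * f + hee * g' * f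
  have hrange : e * (g' * f) = g' * f := by
    linear_combination (norm := noncomm_ring) -hidem.eq_zero_of_mem_jacobson_bot hmem
  have hwg' : w * g' = w := by rw [← hwf, mul_assoc, hfg']
  have hec : e * (g' * b) = g' * b := by
    calc e * (g' * b) = e * (g' * f) * b := by simp only [mul_assoc, hfb]
      _ = g' * b := by rw [hrange, mul_assoc, hfb]
  have hde : d * e = e := by
    rw [hd]
    linear_combination (norm := noncomm_ring) star e * hee
  have hd'e : d' * e = e := by
    calc d' * e = d' * (d * e) := by rw [hde]
      _ = e := by rw [← mul_assoc, hd', one_mul]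
  have hstar : star e * star e = star e := by rw [← star_mul, hee]
  have hsd : star e * d = star e * e := by
    rw [hd]
    linear_combination (norm := noncomm_ring) hstar * e - hstar
  have hsp : star e * (e * d') = star e := by
    rw [← mul_assoc, ← hsd, mul_assoc, hdd', mul_one]
  have hpe : star (e * d') * e = e := by
    simpa only [star_mul, star_star, mul_assoc] using congrArg star hsp
  have hself : star (e * d') = e * d' := by
    have hpp : star (e * d') * (e * d') = e * d' := by rw [← mul_assoc, hpe]
    rw [← hpp, star_mul, star_star]
  have hwy : w * (g' * b * d') = e * d' := by
    rw [he, ← mul_assoc, ← mul_assoc, hwg']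
  have hd'w : d' * w = w := by rw [← hew, ← mul_assoc, hd'e]
  have hyw : g' * b * d' * w = g' * f := by rw [mul_assoc, hd'w, hf, mul_assoc]
  have hd'c : d' * (g' * b) = g' * b := by rw [← hec, ← mul_assoc, hd'e]
  refine ⟨?_, ?_, ?_, ?_, ?_⟩
  · rw [hwy, mul_assoc, hd'w, hew]
  · rw [hyw]
    calc g' * f * (g' * b * d') = g' * (f * g') * b * d' := by simp only [mul_assoc]
      _ = g' * b * d' := by rw [hfg', mul_assoc g', hfb]
  · rw [hwy, hself]
  · calc w * (g' * b * d' * (g' * b * d')) = w * (g' * b * d') * (g' * b) * d' := by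
          simp only [mul_assoc]
      _ = e * (d' * (g' * b)) * d' := by rw [hwy, mul_assoc e]
      _ = g' * b * d' := by rw [hd'c, hec]
  · rw [← mul_assoc, hyw]
    calc g' * f * w = g' * f * e * w := by rw [mul_assoc _ e, hew]
      _ = w := by rw [hme, hew]

/-- for `a` core invertible, `j` in the Jacobson radical with
`(1 - a a^co) j (1 + a^co j)⁻¹ (1 - a^co a) = 0`, the element `a + j` is core
invertible, `1 - γ` and `1 - δ` are invertible, and
`(a + j)^co = (1 - γ)⁻¹ (1 + a^co j)⁻¹ a^co (1 - δ)⁻¹`. -/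
theorem radical_perturbation_core_inverse_formula {R : Type*} [Ring R] [StarRing R]
    (a aco j : R)
    (ha : IsCoreInverse a aco)
    (hj : j ∈ Ideal.jacobson (⊥ : Ideal R))
    (hzero : (1 - a * aco) * j * Ring.inverse (1 + aco * j) * (1 - aco * a) = 0)
    (γ δ : R)
    (hγ : γ = Ring.inverse (1 + aco * j) * (1 - aco * a) * (1 + j * aco) * (a * aco) *
        Ring.inverse (1 + j * aco))
    (hδ : δ = Ring.inverse (1 + star aco * star j) * (star aco * star j) * (1 - a * aco) *
        Ring.inverse (1 + j * aco)) :
    IsUnit (1 - γ) ∧ IsUnit (1 - δ) ∧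
    IsCoreInverse (a + j)
      (Ring.inverse (1 - γ) * Ring.inverse (1 + aco * j) * aco * Ring.inverse (1 - δ)) := by
  obtain ⟨h1, h2, h3, h4, h5⟩ := ha
  obtain ⟨U, hU⟩ := Ideal.isUnit_one_add_of_mem_jacobson_bot (Ideal.mul_mem_left _ aco hj)
  obtain ⟨V, hV⟩ := Ideal.isUnit_one_add_of_mem_jacobson_bot (Ideal.mul_mem_right aco _ hj)
  have hVs : 1 + star aco * star j = ((star V : Rˣ) : R) := by
    rw [Units.coe_star, hV, star_add, star_one, star_mul]
  rw [← hU, Ring.inverse_unit] at hzero hγ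
  rw [← hV, Ring.inverse_unit] at hγ hδ
  rw [hVs, Ring.inverse_unit] at hδ
  rw [← hU, Ring.inverse_unit]
  have hs : ((star V)⁻¹ : Rˣ) = star (V⁻¹) := rfl
  rw [hs, Units.coe_star] at hδ
  have hu1 := U.inv_mul
  have hu2 := U.mul_inv
  have hv1 := V.inv_mul
  have hv2 := V.mul_inv
  rw [hU] at hu1 hu2
  rw [hV] at hv1 hv2 hγ
  generalize ((U⁻¹ : Rˣ) : R) = u at *
  generalize ((V⁻¹ : Rˣ) : R) = v at *
  have hux : u * aco = aco * v := by
    calc u * aco = u * (aco * ((1 + j * aco) * v)) := by rw [hv2, mul_one]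
      _ = u * (1 + aco * j) * (aco * v) := by noncomm_ring
      _ = aco * v := by rw [hu1, one_mul]
  have he : (a + j) * (u * aco) = 1 - (1 - a * aco) * v := by
    rw [hux]
    linear_combination (norm := noncomm_ring) hv2
  have hf : u * aco * (a + j) = 1 - u * (1 - aco * a) := by
    linear_combination (norm := noncomm_ring) hu1
  have hwb : (a + j) * (u * aco) * (a + j) = a + j := by
    have hu3 : u = 1 - aco * j * u := by linear_combination (norm := noncomm_ring) hu2
    have hau : a * u * (1 - aco * a) = - (a * aco * j * u * (1 - aco * a)) := by
      calc a * u * (1 - aco * a) = a * (1 - aco * j * u) * (1 - aco * a) := by rw [← hu3]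
        _ = _ := by linear_combination (norm := noncomm_ring) -h1
    rw [mul_assoc, hf]
    linear_combination (norm := noncomm_ring) -hau - hzero
  have hbw : u * aco * (a + j) * (u * aco) = u * aco := by
    rw [hf, hux]
    linear_combination (norm := noncomm_ring) u * h2 * v
  have hγe : γ = (1 - u * aco * (a + j)) * ((a + j) * (u * aco)) := by
    rw [hf, hγ, hux]
    linear_combination (norm := noncomm_ring) u * (1 - aco * a) * j * h2 * v
  have hsv : star v * (star aco * star j) = 1 - star v := by
    have := congrArg star hv2
    simp only [star_mul, star_add, star_one] at this
    linear_combination (norm := noncomm_ring) this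
  have hpp : a * aco * (a * aco) = a * aco := by rw [← mul_assoc, h1]
  have hδe : δ = star ((a + j) * (u * aco)) * (1 - (a + j) * (u * aco)) := by
    rw [he, hδ, hsv, star_sub, star_mul, star_sub, star_one, h3]
    linear_combination (norm := noncomm_ring) star v * hpp * v
  have hγJ : γ ∈ Ideal.jacobson (⊥ : Ideal R) := by
    have : γ = u * (1 - aco * a) * (j * (aco * v)) := by
      rw [hγ]
      linear_combination (norm := noncomm_ring)
        u * (1 - aco * a) * j * h2 * v - u * h5 * aco * v
    rw [this]
    exact Ideal.mul_mem_left _ _ (Ideal.mul_mem_right _ _ hj)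
  have hδJ : δ ∈ Ideal.jacobson (⊥ : Ideal R) := by
    rw [hδ]
    exact Ideal.mul_mem_right _ _ (Ideal.mul_mem_right _ _ (Ideal.mul_mem_left _ _
      (Ideal.mul_mem_left _ _ (Ideal.star_mem_jacobson_bot hj))))
  have hgu : IsUnit (1 - γ) := by
    simpa only [sub_eq_add_neg] using Ideal.isUnit_one_add_of_mem_jacobson_bot (neg_mem hγJ)
  have hdu : IsUnit (1 - δ) := by
    simpa only [sub_eq_add_neg] using Ideal.isUnit_one_add_of_mem_jacobson_bot (neg_mem hδJ)
  refine ⟨hgu, hdu, ?_⟩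
  have hg1 := Ring.inverse_mul_cancel _ hgu
  have hg2 := Ring.mul_inverse_cancel _ hgu
  rw [mul_assoc (Ring.inverse (1 - γ))]
  refine isCoreInverse_of_reflexive_inverse hwb hbw (by rw [hγe]) hg1 hg2 (by rw [hδe])
    (Ring.inverse_mul_cancel _ hdu) (Ring.mul_inverse_cancel _ hdu) ?_
  generalize Ring.inverse (1 - γ) = g' at *
  have hsplit : (1 - (a + j) * (u * aco)) * (g' * (u * aco * (a + j))) =
      (1 - a * aco) * v * g' * γ * (u * aco * (a + j)) -
      (1 - a * aco) * v * j * (aco * (u * aco * (a + j))) +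
      (1 - a * aco) * u * aco * j * (1 - aco * a) := by
    have hF : (1 - a * aco) * (u * aco * (a + j)) =
        (1 - a * aco) * u * aco * j * (1 - aco * a) := by
      rw [hf]
      linear_combination (norm := noncomm_ring) -(1 - a * aco) * hu1 * (1 - aco * a) - h4 * a
    have hW : 1 - (a + j) * (u * aco) = (1 - a * aco) * v := by rw [he, sub_sub_cancel]
    rw [hW]
    generalize u * aco * (a + j) = F at *
    linear_combination (norm := noncomm_ring)
      (1 - a * aco) * v * hg1 * F + (1 - a * aco) * hv1 * F + hF
  rw [hsplit]
  refine add_mem (sub_mem ?_ ?_) ?_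
  · exact Ideal.mul_mem_right _ _ (Ideal.mul_mem_left _ _ hγJ)
  · exact Ideal.mul_mem_right _ _ (Ideal.mul_mem_left _ _ hj)
  · exact Ideal.mul_mem_right _ _ (Ideal.mul_mem_left _ _ hj)
end
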